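/- arXiv:1009.1239 — 2 statements merged into one kernel-verified Lean document; each statement's English description precedes it below -/
import Mathlib

section
/- If a countably infinite subset S of a lattice L is definable in L and, under the order relation of L, S forms a chain order-isomorphic to the chain of natural numbers, then every member of S is definable in L. -/
open FirstOrder FreeSemigroup

/-! ### First-order definability in lattices

We formalize the first-order language of lattices (two binary function symbols,
interpreted as join and meet) and the notion of a subset of a lattice being
definable by a first-order formula with one free variable. -/

/-- The first-order language of lattices: two binary function symbols
(`0` = join, `1` = meet) and no relation symbols. -/
def latticeLang : Language :=
  ⟨fun n => match n with | 2 => Fin 2 | _ => Empty, fun _ => Empty⟩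

/-- Any lattice is a structure for the language of lattices, interpreting the
function symbol `0` as join `⊔` and the symbol `1` as meet `⊓`. -/
instance latticeStructure (L : Type*) [Lattice L] : latticeLang.Structure L where
  funMap := fun {n} f x =>
    match n, f with
    | 2, f => if (show Fin 2 from f) = 0 then x 0 ⊔ x 1 else x 0 ⊓ x 1
  RelMap := fun {n} r _ => r.elim

/-- A subset `A` of a lattice `L` is definable in `L` if there is a first-order
formula `φ` with one free variable in the language of the lattice operations
such that for all `a ∈ L`, `φ(a)` holds in `L` iff `a ∈ A`. -/
def IsDefinableIn (L : Type*) [Lattice L] (A : Set L) : Prop :=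
  ∃ φ : latticeLang.Formula (Fin 1), ∀ a : L, φ.Realize (fun _ => a) ↔ a ∈ A

/-! ### Semigroup identities and the lattice SEM of all semigroup varieties

A semigroup identity is a pair of words in the free semigroup on countably
many letters.  A semigroup variety is identified with its (semantically closed)
equational theory; the lattice of varieties is the dual of the lattice of
closed theories, ordered by inclusion. -/

/-- Words: elements of the free semigroup over the countable alphabet `ℕ`. -/
abbrev SgWord : Type := FreeSemigroup ℕ

/-- A semigroup identity `u = v` is a pair of words. -/
abbrev SgEq : Type := SgWord × SgWord

/-- A semigroup `S` satisfies the identity `e` if every valuation of the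
letters in `S` gives the two words of `e` equal values. -/
def SatIdent (S : Type) [Semigroup S] (e : SgEq) : Prop :=
  ∀ f : ℕ → S, FreeSemigroup.lift f e.1 = FreeSemigroup.lift f e.2

/-- The semantic closure of a set of identities: all identities holding in
every semigroup satisfying all identities of `E`. -/
def eqClosure (E : Set SgEq) : Set SgEq :=
  {e | ∀ (S : Type) (inst : Semigroup S),
        (∀ e' ∈ E, @SatIdent S inst e') → @SatIdent S inst e}

theorem subset_eqClosure (E : Set SgEq) : E ⊆ eqClosure E :=
  fun e he _S _inst h => h e he

theorem eqClosure_mono {E F : Set SgEq} (h : E ⊆ F) : eqClosure E ⊆ eqClosure F :=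
  fun e he S inst hF => he S inst fun e' he' => hF e' (h he')

theorem eqClosure_idem (E : Set SgEq) : eqClosure (eqClosure E) = eqClosure E := by
  refine Set.Subset.antisymm ?_ (subset_eqClosure _)
  intro e he S inst hE
  exact he S inst fun e' he' => he' S inst hE

/-- An equational theory of semigroups: a semantically closed set of identities. -/
abbrev SemigroupTheory : Type := {E : Set SgEq // eqClosure E = E}

/-- The closed theory generated by a set of identities. -/
def theoryClosure (E : Set SgEq) : SemigroupTheory := ⟨eqClosure E, eqClosure_idem E⟩

theorem theoryGC : GaloisConnection theoryClosure Subtype.val := by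
  intro E T
  constructor
  · intro h
    exact (subset_eqClosure E).trans h
  · intro h
    show eqClosure E ⊆ T.val
    rw [← T.2]
    exact eqClosure_mono h

def theoryGI : GaloisInsertion theoryClosure Subtype.val :=
  theoryGC.toGaloisInsertion fun T => subset_eqClosure T.val

instance : CompleteLattice SemigroupTheory := theoryGI.liftCompleteLattice

/-- The lattice **SEM** of all semigroup varieties: a variety is identified with
its equational theory, and the order (inclusion of varieties) is the dual of
inclusion of theories. -/
abbrev SemigroupVariety : Type := SemigroupTheoryᵒᵈ

/-- The set of identities holding in a variety. -/
def SemigroupVariety.ids (V : SemigroupVariety) : Set SgEq := (OrderDual.ofDual V).val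

/-- `var Σ`: the semigroup variety given by the identity system `Σ`. -/
def varOf (E : Set SgEq) : SemigroupVariety := OrderDual.toDual (theoryClosure E)

/-- Membership of a semigroup in a variety. -/
def MemVar (S : Type) [Semigroup S] (V : SemigroupVariety) : Prop :=
  ∀ e ∈ V.ids, SatIdent S e

/-- A set of semigroup varieties is definable if it is definable in the
lattice **SEM** of all semigroup varieties. -/
def IsDefinableVar (A : Set SemigroupVariety) : Prop :=
  IsDefinableIn SemigroupVariety A

/-! ### Words, powers, products of lists -/

/-- The letters `x`, `y`, `z`. -/
def wx : SgWord := of 0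
def wy : SgWord := of 1
def wz : SgWord := of 2

/-- `sPow a n = a ^ (n + 1)` in any magma. -/
def sPow {S : Type*} [Mul S] (a : S) : ℕ → S
  | 0 => a
  | n + 1 => sPow a n * a

/-- `sProd a l` is the product of the nonempty list `a :: l`. -/
def sProd {S : Type*} [Mul S] : S → List S → S
  | a, [] => a
  | a, b :: l => a * sProd b l

/-- The word given by a nonempty list of letters (junk value `x` on `[]`). -/
def wordOfList : List ℕ → SgWord
  | [] => of 0
  | x :: l => sProd (of x) (l.map of)

/-- The letter `x` occurs in the word `w`. -/
def occursIn (x : ℕ) (w : SgWord) : Prop := x = w.head ∨ x ∈ w.tail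

/-- The pair of identities `w x = w` and `x w = w` abbreviated by the symbolic
identity `w = 0` (here `x` is a letter, intended not to occur in `w`). -/
def zeroPairs (w : SgWord) (x : ℕ) : Set SgEq := {(w * of x, w), (of x * w, w)}

/-- A 0-reduced semigroup variety: one that may be given by identities of the
form `w = 0` only (a nonempty system of them). -/
def IsZeroReducedVariety (V : SemigroupVariety) : Prop :=
  ∃ I : Set (SgWord × ℕ), I.Nonempty ∧ (∀ p ∈ I, ¬ occursIn p.2 p.1) ∧
    V = varOf (⋃ p ∈ I, zeroPairs p.1 p.2)

/-- A commutative variety 0-reduced in **Com**: one that may be given by the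
commutative law together with a nonempty system of 0-reduced identities only. -/
def IsZeroReducedInCom (V : SemigroupVariety) : Prop :=
  ∃ I : Set (SgWord × ℕ), I.Nonempty ∧ (∀ p ∈ I, ¬ occursIn p.2 p.1) ∧
    V = varOf (insert (wx * wy, wy * wx) (⋃ p ∈ I, zeroPairs p.1 p.2))

/-! ### Particular varieties -/

/-- `COM = var{xy = yx}`, the variety of commutative semigroups. -/
def COMvar : SemigroupVariety := varOf {(wx * wy, wy * wx)}

/-- `SL = var{x² = x, xy = yx}`, the variety of semilattices. -/
def SLvar : SemigroupVariety := varOf {(wx * wx, wx), (wx * wy, wy * wx)}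

/-- `ZM = var{xy = 0}`, the variety of null semigroups. -/
def ZMvar : SemigroupVariety := varOf (zeroPairs (wx * wy) 2)

/-- `LZ = var{xy = x}`, the variety of left zero semigroups. -/
def LZvar : SemigroupVariety := varOf {(wx * wy, wx)}

/-- `RZ = var{xy = y}`, the variety of right zero semigroups. -/
def RZvar : SemigroupVariety := varOf {(wx * wy, wy)}

/-- `A_n = var{xⁿy = y, xy = yx}` (for `n ≥ 1`), the variety of Abelian groups
whose exponent divides `n`. -/
def Avar (n : ℕ) : SemigroupVariety :=
  varOf {(sPow wx (n - 1) * wy, wy), (wx * wy, wy * wx)}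

/-- `N_k = var{x² = x₁x₂⋯x_k = 0, xy = yx}` (for `k ≥ 1`). -/
def Nvar (k : ℕ) : SemigroupVariety :=
  varOf (zeroPairs (wx * wx) 1 ∪ zeroPairs (wordOfList (List.range k)) k ∪
    {(wx * wy, wy * wx)})

/-- `N_ω = var{x² = 0, xy = yx}`. -/
def Nomega : SemigroupVariety :=
  varOf (zeroPairs (wx * wx) 1 ∪ {(wx * wy, wy * wx)})

/-- `N₃² = var{x² = xyz = 0}`. -/
def N32var : SemigroupVariety :=
  varOf (zeroPairs (wx * wx) 1 ∪ zeroPairs (wx * wy * wz) 3)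

/-- `N₃^c = var{xyz = 0, xy = yx}`. -/
def N3cvar : SemigroupVariety :=
  varOf (zeroPairs (wx * wy * wz) 3 ∪ {(wx * wy, wy * wx)})

/-- `NILP_k = var{x₁x₂⋯x_k = 0}` (for `k ≥ 1`). -/
def NILPvar (k : ℕ) : SemigroupVariety :=
  varOf (zeroPairs (wordOfList (List.range k)) k)

/-- `P = var{xy = x²y, x²y² = y²x²}`. -/
def Pvar : SemigroupVariety :=
  varOf {(wx * wy, wx * wx * wy), (wx * wx * (wy * wy), wy * wy * (wx * wx))}

/-- `D_m = var{x^m = 0, xy = yx}` (for `m ≥ 1`). -/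
def Dvar (m : ℕ) : SemigroupVariety :=
  varOf (zeroPairs (sPow wx (m - 1)) 1 ∪ {(wx * wy, wy * wx)})

/-- `E_m = var{x^m = 0}` (for `m ≥ 1`). -/
def Evar (m : ℕ) : SemigroupVariety :=
  varOf (zeroPairs (sPow wx (m - 1)) 1)

/-- `F = var{x²y = xyx = yx² = 0}`. -/
def Fvar : SemigroupVariety :=
  varOf (zeroPairs (wx * wx * wy) 2 ∪ zeroPairs (wx * wy * wx) 2 ∪
    zeroPairs (wy * (wx * wx)) 2)

/-- `H = var{x² = xyx = 0}`. -/
def Hvar : SemigroupVariety :=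
  varOf (zeroPairs (wx * wx) 1 ∪ zeroPairs (wx * wy * wx) 2)

/-- `C_0` is the trivial variety; `C_m = var{x^m = x^{m+1}, xy = yx}` for
`m ≥ 1` (the variety generated by the cyclic monoid `⟨a ∣ a^m = a^{m+1}⟩`). -/
def Cvar : ℕ → SemigroupVariety
  | 0 => varOf {(wx, wy)}
  | m + 1 => varOf {(sPow wx m, sPow wx (m + 1)), (wx * wy, wy * wx)}

/-! ### Duality -/

/-- The reverse of a word. -/
def revWord (w : SgWord) : SgWord :=
  MulOpposite.unop (FreeSemigroup.lift (fun x => MulOpposite.op (of x)) w)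

theorem revWord_of (x : ℕ) : revWord (of x) = of x := by
  simp [revWord]

theorem revWord_mul (u v : SgWord) : revWord (u * v) = revWord v * revWord u := by
  simp [revWord]

theorem lift_op {S : Type} [Semigroup S] (g : ℕ → S) (w : SgWord) :
    FreeSemigroup.lift (fun x => MulOpposite.op (g x)) w
      = MulOpposite.op (FreeSemigroup.lift g (revWord w)) := by
  induction w using FreeSemigroup.recOnMul with
  | ih1 x => simp [revWord_of]
  | ih2 x y ih1 ih2 => simp [revWord_mul, revWord_of, map_mul, ih2]

theorem satIdent_op_iff {S : Type} [Semigroup S] (e : SgEq) :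
    SatIdent Sᵐᵒᵖ e ↔ SatIdent S (revWord e.1, revWord e.2) := by
  constructor
  · intro h f
    have h1 := h fun x => MulOpposite.op (f x)
    rw [lift_op, lift_op] at h1
    exact MulOpposite.op_injective h1
  · intro h g
    have h1 : g = fun x => MulOpposite.op (MulOpposite.unop (g x)) := by
      funext x; simp
    rw [h1, lift_op, lift_op]
    exact congrArg _ (h fun x => MulOpposite.unop (g x))

/-- The set of identities of the dual variety: `e` holds in the dual of `V`
iff the reversed identity holds in `V`. -/
def dualIds (E : Set SgEq) : Set SgEq := {e | (revWord e.1, revWord e.2) ∈ E}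

theorem dualIds_closed (T : SemigroupTheory) :
    eqClosure (dualIds T.val) = dualIds T.val := by
  refine Set.Subset.antisymm ?_ (subset_eqClosure _)
  intro e he
  show (revWord e.1, revWord e.2) ∈ T.val
  rw [← T.2]
  intro S instS hS
  have hop : ∀ e' ∈ dualIds T.val, SatIdent Sᵐᵒᵖ e' := by
    intro e' he'
    rw [satIdent_op_iff]
    exact hS _ he'
  exact (satIdent_op_iff e).mp (he Sᵐᵒᵖ inferInstance hop)

/-- The variety dual to `V`, consisting of the semigroups anti-isomorphic to
members of `V`. -/
def dualVariety (V : SemigroupVariety) : SemigroupVariety :=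
  OrderDual.toDual ⟨dualIds (OrderDual.ofDual V).val, dualIds_closed _⟩

/-! ### The variety generated by a semigroup -/

/-- The equational theory of a semigroup `S`. -/
def theoryOf (S : Type) [Semigroup S] : Set SgEq := {e | SatIdent S e}

theorem theoryOf_closed (S : Type) [inst : Semigroup S] :
    eqClosure (theoryOf S) = theoryOf S := by
  refine Set.Subset.antisymm ?_ (subset_eqClosure _)
  intro e he
  exact he S inst fun e' he' => he'

/-- The variety generated by a semigroup `S`: the least variety containing `S`. -/
def varGeneratedBy (S : Type) [Semigroup S] : SemigroupVariety :=
  OrderDual.toDual ⟨theoryOf S, theoryOf_closed S⟩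

/-! ### Semantic properties of semigroups and of varieties -/

/-- A periodic semigroup: every element has two equal distinct powers. -/
def IsPeriodicSemigroup (S : Type) [Semigroup S] : Prop :=
  ∀ a : S, ∃ m n : ℕ, m < n ∧ sPow a m = sPow a n

/-- A zero element of a semigroup. -/
def IsZeroElem {S : Type} [Semigroup S] (z : S) : Prop :=
  ∀ a : S, z * a = z ∧ a * z = z

/-- A nil-semigroup: a semigroup with zero in which some power of every
element is zero. -/
def IsNilSemigroup (S : Type) [Semigroup S] : Prop :=
  ∃ z : S, IsZeroElem z ∧ ∀ a : S, ∃ n : ℕ, sPow a n = z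

/-- A semigroup is nilpotent of degree at most `k` if all products of at
least `k` elements coincide (and are then a zero element). -/
def IsNilpotentLe (S : Type) [Semigroup S] (k : ℕ) : Prop :=
  ∃ z : S, ∀ (a : S) (l : List S), k ≤ l.length + 1 → sProd a l = z

/-- A nilpotent semigroup. -/
def IsNilpotentSemigroup (S : Type) [Semigroup S] : Prop :=
  ∃ k : ℕ, IsNilpotentLe S k

/-- A completely regular semigroup: a union of groups; equivalently every
element `a` has an inverse commuting with `a`. -/
def IsCompletelyRegularSemigroup (S : Type) [Semigroup S] : Prop :=
  ∀ a : S, ∃ x : S, a = a * x * a ∧ a * x = x * a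

/-- A (two-sided) ideal of a semigroup. -/
def IsIdeal {S : Type} [Semigroup S] (I : Set S) : Prop :=
  ∀ a ∈ I, ∀ s : S, s * a ∈ I ∧ a * s ∈ I

/-- A simple semigroup: no proper nonempty ideals. -/
def IsSimpleSemigroup (S : Type) [Semigroup S] : Prop :=
  ∀ I : Set S, I.Nonempty → IsIdeal I → I = Set.univ

/-- A completely simple semigroup: a simple semigroup possessing a primitive
idempotent. -/
def IsCompletelySimpleSemigroup (S : Type) [Semigroup S] : Prop :=
  IsSimpleSemigroup S ∧
    ∃ e : S, e * e = e ∧ ∀ f : S, f * f = f → f * e = f → e * f = f → f = e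

/-- A semigroup which is a group. -/
def IsGroupSemigroup (S : Type) [Semigroup S] : Prop :=
  ∃ e : S, (∀ a : S, e * a = a ∧ a * e = a) ∧ ∀ a : S, ∃ b : S, a * b = e ∧ b * a = e

/-- A subset of a semigroup which is a subgroup. -/
def IsSubgroupSet {S : Type} [Semigroup S] (G : Set S) : Prop :=
  (∀ a ∈ G, ∀ b ∈ G, a * b ∈ G) ∧
    ∃ e ∈ G, (∀ a ∈ G, e * a = a ∧ a * e = a) ∧
      ∀ a ∈ G, ∃ b ∈ G, a * b = e ∧ b * a = e

/-- A periodic variety: all members are periodic semigroups. -/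
def IsPeriodicVariety (V : SemigroupVariety) : Prop :=
  ∀ (S : Type) [Semigroup S], MemVar S V → IsPeriodicSemigroup S

/-- A nil-variety: all members are nil-semigroups. -/
def IsNilVariety (V : SemigroupVariety) : Prop :=
  ∀ (S : Type) [Semigroup S], MemVar S V → IsNilSemigroup S

/-- A completely regular variety: all members are completely regular. -/
def IsCompletelyRegularVariety (V : SemigroupVariety) : Prop :=
  ∀ (S : Type) [Semigroup S], MemVar S V → IsCompletelyRegularSemigroup S

/-- A completely simple variety: all members are completely simple. -/
def IsCompletelySimpleVariety (V : SemigroupVariety) : Prop :=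
  ∀ (S : Type) [Semigroup S], MemVar S V → IsCompletelySimpleSemigroup S

/-- A periodic group variety: all members are periodic groups. -/
def IsPeriodicGroupVariety (V : SemigroupVariety) : Prop :=
  ∀ (S : Type) [Semigroup S], MemVar S V → IsGroupSemigroup S ∧ IsPeriodicSemigroup S

/-- A combinatorial variety: all subgroups of all members are trivial. -/
def IsCombinatorialVariety (V : SemigroupVariety) : Prop :=
  ∀ (S : Type) [Semigroup S], MemVar S V →
    ∀ G : Set S, IsSubgroupSet G → G.Subsingleton

/-- An Abelian periodic group variety: all members are Abelian periodic groups. -/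
def IsAbelianPeriodicGroupVariety (V : SemigroupVariety) : Prop :=
  ∀ (S : Type) [Semigroup S], MemVar S V →
    IsGroupSemigroup S ∧ (∀ a b : S, a * b = b * a) ∧ IsPeriodicSemigroup S

/-- A chain variety: the lattice of its subvarieties is a chain. -/
def IsChainVariety (V : SemigroupVariety) : Prop :=
  ∀ W₁ W₂ : SemigroupVariety, W₁ ≤ V → W₂ ≤ V → W₁ ≤ W₂ ∨ W₂ ≤ W₁

/-! ### Degrees, nilpotency, completely regular powers -/

/-- A variety of finite degree: all its nil-members are nilpotent. -/
def IsFiniteDegreeVariety (V : SemigroupVariety) : Prop :=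
  ∀ (S : Type) [Semigroup S], MemVar S V → IsNilSemigroup S → IsNilpotentSemigroup S

/-- The nilpotency degrees of nil-members of `V` are bounded by `k`. -/
def DegreeBoundedBy (V : SemigroupVariety) (k : ℕ) : Prop :=
  ∀ (S : Type) [Semigroup S], MemVar S V → IsNilSemigroup S → IsNilpotentLe S k

/-- `V` is a variety of degree `k`: the nilpotency degrees of its nil-members
are bounded by `k` and `k` is the least such (positive) number. -/
def HasDegree (V : SemigroupVariety) (k : ℕ) : Prop :=
  DegreeBoundedBy V k ∧ ∀ j : ℕ, 1 ≤ j → j < k → ¬ DegreeBoundedBy V j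

/-- A nilpotent variety: one satisfying an identity `x₁x₂⋯x_k = 0`. -/
def IsNilpotentVariety (V : SemigroupVariety) : Prop :=
  ∃ k : ℕ, 1 ≤ k ∧ zeroPairs (wordOfList (List.range k)) k ⊆ V.ids

/-- The `k`-th power of a semigroup `S`: the set of products of `k` elements. -/
def powSet (S : Type) [Semigroup S] (k : ℕ) : Set S :=
  {s | ∃ (a : S) (l : List S), l.length + 1 = k ∧ s = sProd a l}

/-- The `k`-th power of `S` is a completely regular subsemigroup. -/
def HasCRPow (S : Type) [Semigroup S] (k : ℕ) : Prop :=
  ∀ a ∈ powSet S k, ∃ x ∈ powSet S k, a = a * x * a ∧ a * x = x * a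

/-- All members of `V` have completely regular `k`-th power. -/
def CRPowAll (V : SemigroupVariety) (k : ℕ) : Prop :=
  ∀ (S : Type) [Semigroup S], MemVar S V → HasCRPow S k

/-- A variety of semigroups with completely regular power. -/
def IsCRPowerVariety (V : SemigroupVariety) : Prop :=
  ∀ (S : Type) [Semigroup S], MemVar S V → ∃ n : ℕ, 1 ≤ n ∧ HasCRPow S n

/-- A variety of semigroups with completely regular `k`-th power: `S^k` is
completely regular for every member `S`, and `k` is the least such (positive)
number. -/
def IsCRkPowerVariety (V : SemigroupVariety) (k : ℕ) : Prop :=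
  CRPowAll V k ∧ ∀ j : ℕ, 1 ≤ j → j < k → ¬ CRPowAll V j

/-! ### Permutational identities -/

/-- The permutational identity `x₁x₂⋯x_n = x_{1α}x_{2α}⋯x_{nα}` of length `n`
determined by a non-trivial permutation `α` of `{1, …, n}`. -/
def IsPermIdentOfLength (n : ℕ) (e : SgEq) : Prop :=
  ∃ σ : Equiv.Perm (Fin n), σ ≠ 1 ∧
    e = (wordOfList (List.ofFn fun i : Fin n => (i : ℕ)),
         wordOfList (List.ofFn fun i : Fin n => ((σ i : Fin n) : ℕ)))

/-- `PERM_n`: the variety given by all permutational identities of length `n`. -/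
def PERMvar (n : ℕ) : SemigroupVariety :=
  varOf {e | IsPermIdentOfLength n e}

/-- A permutative variety: one satisfying some permutational identity. -/
def IsPermutativeVariety (V : SemigroupVariety) : Prop :=
  ∃ (n : ℕ) (e : SgEq), IsPermIdentOfLength n e ∧ e ∈ V.ids

/-- A strongly permutative variety: one satisfying a permutational identity
with `1α ≠ 1` and `nα ≠ n`. -/
def IsStronglyPermutativeVariety (V : SemigroupVariety) : Prop :=
  ∃ (n : ℕ) (σ : Equiv.Perm (Fin (n + 2))),
    σ 0 ≠ 0 ∧ σ (Fin.last (n + 1)) ≠ Fin.last (n + 1) ∧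
    (wordOfList (List.ofFn fun i : Fin (n + 2) => (i : ℕ)),
     wordOfList (List.ofFn fun i : Fin (n + 2) => ((σ i : Fin (n + 2)) : ℕ))) ∈ V.ids

/-! ### Nil part and 0-reduced closure in Com -/

/-- `Nil(V)`: the greatest nil-subvariety of (a periodic variety) `V`. -/
def NilPart (V : SemigroupVariety) : SemigroupVariety :=
  sSup {W : SemigroupVariety | W ≤ V ∧ IsNilVariety W}

/-- `ZR(X)`: the least variety 0-reduced in **Com** containing `X`. -/
def ZRPart (X : SemigroupVariety) : SemigroupVariety :=
  sInf {W : SemigroupVariety | X ≤ W ∧ IsZeroReducedInCom W}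

/-- The join of two terms of the language of lattices. -/
def supTerm {α : Type*} (s t : latticeLang.Term α) : latticeLang.Term α :=
  Language.Term.func (l := 2) (show Fin 2 from 0) ![s, t]

theorem realize_supTerm {L : Type*} [Lattice L] {α : Type*} (s t : latticeLang.Term α)
    (v : α → L) : (supTerm s t).realize v = s.realize v ⊔ t.realize v :=
  rfl

theorem IsDefinableIn.sdiff {L : Type*} [Lattice L] {A B : Set L} (hA : IsDefinableIn L A)
    (hB : IsDefinableIn L B) : IsDefinableIn L (A \ B) := by
  obtain ⟨φ, hφ⟩ := hA
  obtain ⟨ψ, hψ⟩ := hB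
  refine ⟨φ ⊓ ψ.not, fun a => ?_⟩
  rw [Language.Formula.realize_inf, Language.Formula.realize_not, hφ, hψ, Set.mem_sdiff]

/-- The set of least elements of a definable set is definable. -/
theorem IsDefinableIn.isLeast {L : Type*} [Lattice L] {A : Set L} (hA : IsDefinableIn L A) :
    IsDefinableIn L {a | IsLeast A a} := by
  obtain ⟨φ, hφ⟩ := hA
  let y : latticeLang.Term (Fin 1 ⊕ Fin 1) := Language.Term.var (Sum.inr 0)
  let below : latticeLang.Formula (Fin 1 ⊕ Fin 1) :=
    (supTerm (Language.Term.var (Sum.inl 0)) y).equal y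
  let φy : latticeLang.Formula (Fin 1 ⊕ Fin 1) := φ.relabel Sum.inr
  refine ⟨φ ⊓ (φy.imp below).iAlls (Fin 1), fun a => ?_⟩
  have hy (i : Fin 1 → L) : φ.Realize i ↔ i 0 ∈ A := by
    rw [← hφ, show (fun _ => i 0) = i from funext fun j => by rw [Subsingleton.elim j 0] ]
  simp only [Language.Formula.realize_inf, Language.Formula.realize_iAlls,
    Language.Formula.realize_imp, φy, below, y, Language.Formula.realize_relabel,
    Language.Formula.realize_equal, realize_supTerm, Language.Term.realize_var,
    Sum.elim_comp_inr, Sum.elim_inl, Sum.elim_inr, sup_eq_right, hφ, hy]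
  exact and_congr_right fun _ => ⟨fun h b hb => h (fun _ => b) hb, fun h i hi => h hi⟩

/-- If a countably infinite subset `S` of a lattice `L` is
definable in `L` and, under the order of `L`, forms a chain order-isomorphic
to the chain of natural numbers, then every member of `S` is definable in `L`. -/
theorem definable_of_mem_definable_nat_chain {L : Type*} [Lattice L] (S : Set L)
    (hcount : S.Countable) (hinf : S.Infinite)
    (hchain : Nonempty (ℕ ≃o S))
    (hdef : IsDefinableIn L S) :
    ∀ s ∈ S, IsDefinableIn L {s} := by
  obtain ⟨e⟩ := hchain
  have least (n : ℕ) : {a | IsLeast {x : L | ∃ k, n ≤ k ∧ (e k : L) = x} a} = {(e n : L)} := by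
    have hn : IsLeast {x : L | ∃ k, n ≤ k ∧ (e k : L) = x} (e n) :=
      ⟨⟨n, le_rfl, rfl⟩, fun _ ⟨_, hk, hx⟩ => hx ▸ e.monotone hk⟩
    exact Set.ext fun a => ⟨fun ha => ha.unique hn, fun ha => ha ▸ hn⟩
  have tail (n : ℕ) : IsDefinableIn L {x : L | ∃ k, n ≤ k ∧ (e k : L) = x} := by
    induction n with
    | zero =>
      convert hdef using 1
      ext x
      exact ⟨fun ⟨k, _, hx⟩ => hx ▸ (e k).2,
        fun hx => ⟨e.symm ⟨x, hx⟩, Nat.zero_le _, by simp⟩⟩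
    | succ n ih =>
      convert ih.sdiff (least n ▸ ih.isLeast) using 1
      ext x
      constructor
      · rintro ⟨k, hk, rfl⟩
        refine ⟨⟨k, by omega, rfl⟩, fun h => ?_⟩
        have := e.injective (Subtype.ext h)
        omega
      · rintro ⟨⟨k, hk, rfl⟩, h⟩
        refine ⟨k, lt_of_le_of_ne hk ?_, rfl⟩
        rintro rfl
        exact h rfl
  intro s hs
  have := (tail (e.symm ⟨s, hs⟩)).isLeast
  rwa [least, OrderIso.apply_symm_apply] at this
end

section
/- The variety COM = var{xy = yx} of all commutative semigroups is definable. -/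
open FirstOrder FreeSemigroup

/-! ### The order on varieties -/

theorem SemigroupVariety.mem_ids_iff (V : SemigroupVariety) (e : SgEq) :
    e ∈ V.ids ↔ ∀ (T : Type) [Semigroup T], MemVar T V → SatIdent T e := by
  constructor
  · intro h T _ hT
    exact hT e h
  · intro h
    have hV : eqClosure V.ids = V.ids := (OrderDual.ofDual V).2
    rw [← hV]
    exact fun T _ hT => h T hT

theorem varGeneratedBy_le_iff {S : Type} [Semigroup S] {V : SemigroupVariety} :
    varGeneratedBy S ≤ V ↔ MemVar S V := Iff.rfl

theorem le_COMvar_iff {V : SemigroupVariety} :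
    V ≤ COMvar ↔ ∀ (T : Type) [Semigroup T], MemVar T V → ∀ a b : T, a * b = b * a := by
  constructor
  · intro h T _ hT a b
    have h1 : (wx * wy, wy * wx) ∈ V.ids := h (subset_eqClosure _ rfl)
    simpa [wx, wy] using hT _ h1 fun i => if i = 0 then a else b
  · intro h e he
    refine (V.mem_ids_iff e).2 fun T _ hT => he T _ ?_
    rintro e' rfl f
    simp only [map_mul]
    exact h T hT _ _

theorem varGeneratedBy_le_COMvar {S : Type} [Semigroup S] (h : ∀ a b : S, a * b = b * a) :
    varGeneratedBy S ≤ COMvar := by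
  rw [varGeneratedBy_le_iff]
  intro e he
  refine he S _ ?_
  rintro e' rfl f
  simp only [map_mul]
  exact h _ _

theorem not_varGeneratedBy_le_all (S : Type) [Semigroup S] [Nontrivial S] :
    ¬ ∀ V : SemigroupVariety, varGeneratedBy S ≤ V := by
  intro h
  obtain ⟨a, b, hab⟩ := exists_pair_ne S
  have h1 : ((wx, wy) : SgEq) ∈ theoryOf S :=
    h (varGeneratedBy (Multiplicative (ZMod 1))) fun f => Subsingleton.elim _ _
  apply hab
  simpa [wx, wy] using h1 fun i => if i = 0 then a else b

theorem le_all_of_subsingleton {V : SemigroupVariety}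
    (h : ∀ (T : Type) [Semigroup T], MemVar T V → Subsingleton T) (W : SemigroupVariety) :
    V ≤ W :=
  fun e _ => (V.mem_ids_iff e).2 fun T _ hT _ => (h T hT).elim _ _

theorem exists_failing_of_not_memVar {S : Type} [Semigroup S] {V : SemigroupVariety}
    (h : ¬ MemVar S V) :
    ∃ e ∈ V.ids, ∃ f : ℕ → S, FreeSemigroup.lift f e.1 ≠ FreeSemigroup.lift f e.2 := by
  simpa [MemVar, SatIdent] using h

/-! ### Two-element semigroups -/

/-- The two-element semilattice. -/
def TwoSemilattice : Type := Bool

/-- The two-element null semigroup, with zero `false`. -/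
def TwoNull : Type := Bool

/-- The two-element left zero semigroup. -/
def TwoLeftZero : Type := Bool

/-- The two-element right zero semigroup. -/
def TwoRightZero : Type := Bool

instance : Semigroup TwoSemilattice where
  mul a b := and a b
  mul_assoc := Bool.and_assoc

instance : Semigroup TwoNull where
  mul _ _ := false
  mul_assoc _ _ _ := rfl

instance : Semigroup TwoLeftZero where
  mul a _ := a
  mul_assoc _ _ _ := rfl

instance : Semigroup TwoRightZero where
  mul _ b := b
  mul_assoc _ _ _ := rfl

instance : Nontrivial TwoSemilattice := inferInstanceAs (Nontrivial Bool)
instance : Nontrivial TwoNull := inferInstanceAs (Nontrivial Bool)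
instance : Nontrivial TwoLeftZero := inferInstanceAs (Nontrivial Bool)
instance : Nontrivial TwoRightZero := inferInstanceAs (Nontrivial Bool)

theorem eq_of_cond_eq_of_ne {T : Type} {x y : T} {a b : Bool} (hab : a ≠ b)
    (h : cond a x y = cond b x y) : x = y := by
  cases a <;> cases b <;> simp_all

theorem mul_eq_left_of_not_rightZero {T : Type} [Semigroup T] {V : SemigroupVariety}
    (hT : MemVar T V) (hV : ¬ MemVar TwoRightZero V) (hrect : ∀ a b : T, a * b * a = a)
    (x y : T) (hx : x * x = x) : x * y = x := by
  obtain ⟨e, he, f, hf⟩ := exists_failing_of_not_memVar hV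
  have hmid : ∀ s t : T, x * (s * t) = x * t := fun s t => by
    calc x * (s * t) = x * (s * (t * x * t)) := by rw [hrect]
      _ = x * (s * t) * x * t := by simp only [mul_assoc]
      _ = x * t := by rw [hrect]
  have key : ∀ w : SgWord, x * FreeSemigroup.lift (fun i => cond (f i) x y) w
      = cond (FreeSemigroup.lift f w) (x * x) (x * y) := by
    intro w
    induction w using FreeSemigroup.recOnMul with
    | ih1 i => 
      simp only [FreeSemigroup.lift_of]
      rcases Bool.eq_false_or_eq_true (f i) with h | h <;> rw [h] <;> rfl
    | ih2 i v _ ih =>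
      simp only [map_mul]
      rw [hmid, ih]
      rfl
  have h1 := congrArg (x * ·) (hT e he fun i => cond (f i) x y)
  simp only [key] at h1
  exact (eq_of_cond_eq_of_ne hf h1).symm.trans hx

theorem mul_eq_right_of_not_leftZero {T : Type} [Semigroup T] {V : SemigroupVariety}
    (hT : MemVar T V) (hV : ¬ MemVar TwoLeftZero V) (hrect : ∀ a b : T, a * b * a = a)
    (x y : T) (hx : x * x = x) : y * x = x := by
  obtain ⟨e, he, f, hf⟩ := exists_failing_of_not_memVar hV
  have hmid : ∀ s t : T, s * t * x = s * x := fun s t => by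
    calc s * t * x = s * x * s * t * x := by rw [hrect]
      _ = s * (x * (s * t) * x) := by simp only [mul_assoc]
      _ = s * x := by rw [hrect]
  have key : ∀ w : SgWord, FreeSemigroup.lift (fun i => cond (f i) x y) w * x
      = cond (FreeSemigroup.lift f w) (x * x) (y * x) := by
    intro w
    induction w using FreeSemigroup.recOnMul with
    | ih1 i => 
      simp only [FreeSemigroup.lift_of]
      rcases Bool.eq_false_or_eq_true (f i) with h | h <;> rw [h] <;> rfl
    | ih2 i v ih _ =>
      simp only [map_mul]
      rw [hmid, ih]
      rfl
  have h1 := congrArg (· * x) (hT e he fun i => cond (f i) x y)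
  simp only [key] at h1
  exact (eq_of_cond_eq_of_ne hf h1).symm.trans hx

theorem rectangular_of_not_semilattice {T : Type} [Semigroup T] {V : SemigroupVariety}
    (hT : MemVar T V) (hV : ¬ MemVar TwoSemilattice V) (hidem : ∀ a : T, a * a = a)
    (x y : T) : x * y * x = x := by
  obtain ⟨e, he, f, hf⟩ := exists_failing_of_not_memVar hV
  have h1 : x * (x * y * x) = x * y * x := by simp only [← mul_assoc, hidem]
  have h2 : x * y * x * x = x * y * x := by rw [mul_assoc, hidem]
  have key : ∀ w : SgWord, FreeSemigroup.lift (fun i => cond (f i) x (x * y * x)) w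
      = cond (FreeSemigroup.lift f w) x (x * y * x) := by
    intro w
    induction w using FreeSemigroup.recOnMul with
    | ih1 i => simp only [FreeSemigroup.lift_of]
    | ih2 i v hi hv =>
      simp only [map_mul]
      rw [hi, hv]
      generalize FreeSemigroup.lift f (of i) = a
      generalize FreeSemigroup.lift f v = b
      change Bool at a b
      change _ = cond (and a b) _ _
      cases a <;> cases b <;> simp [hidem, h1, h2]
  have h3 := hT e he fun i => cond (f i) x (x * y * x)
  rw [key, key] at h3
  exact (eq_of_cond_eq_of_ne hf h3).symm

/-! ### Powers -/

theorem sPow_eq_iterate {T : Type} [Semigroup T] (t : T) (n : ℕ) :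
    sPow t n = (fun s => s * t)^[n] t := by
  induction n with
  | zero => rfl
  | succ n ih => rw [Function.iterate_succ_apply', ← ih]; rfl

theorem sPow_mul_sPow {T : Type*} [Semigroup T] (t : T) (m n : ℕ) :
    sPow t m * sPow t n = sPow t (m + n + 1) := by
  induction n with
  | zero => rfl
  | succ n ih => rw [sPow, ← mul_assoc, ih]; rfl

theorem lift_sPow {T : Type} [Semigroup T] (f : ℕ → T) (w : SgWord) (n : ℕ) :
    FreeSemigroup.lift f (sPow w n) = sPow (FreeSemigroup.lift f w) n := by
  induction n with
  | zero => rfl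
  | succ n ih => rw [sPow, map_mul, ih]; rfl

theorem sPow_eq_pow {M : Type} [Monoid M] (a : M) (n : ℕ) : sPow a n = a ^ (n + 1) := by
  induction n with
  | zero => simp [sPow]
  | succ n ih => rw [sPow, ih, pow_succ a (n + 1)]

theorem exists_sPow_eq_of_not_null {T : Type} [Semigroup T] {V : SemigroupVariety}
    (hT : MemVar T V) (hV : ¬ MemVar TwoNull V) (t : T) : ∃ n, sPow t (n + 1) = t := by
  obtain ⟨e, he, f, hf⟩ := exists_failing_of_not_memVar hV
  have hpow : ∀ w : SgWord, ∃ n,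
      FreeSemigroup.lift (fun i => cond (f i) t (t * t)) w = sPow t n := by
    intro w
    induction w using FreeSemigroup.recOnMul with
    | ih1 i =>
      simp only [FreeSemigroup.lift_of]
      rcases Bool.eq_false_or_eq_true (f i) with h | h <;> rw [h]
      exacts [⟨0, rfl⟩, ⟨1, rfl⟩]
    | ih2 i v hi hv =>
      obtain ⟨m, hm⟩ := hi
      obtain ⟨n, hn⟩ := hv
      exact ⟨m + n + 1, by rw [map_mul, hm, hn, sPow_mul_sPow]⟩
  have key : ∀ w : SgWord,
      (FreeSemigroup.lift f w = true →
        FreeSemigroup.lift (fun i => cond (f i) t (t * t)) w = t) ∧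
      (FreeSemigroup.lift f w = false → ∃ n,
        FreeSemigroup.lift (fun i => cond (f i) t (t * t)) w = sPow t (n + 1)) := by
    intro w
    induction w using FreeSemigroup.recOnMul with
    | ih1 i =>
      simp only [FreeSemigroup.lift_of]
      refine ⟨fun h => by rw [h]; rfl, fun h => ⟨0, ?_⟩⟩
      rw [h]
      rfl
    | ih2 i v _ _ =>
      refine ⟨fun h => ?_, fun _ => ?_⟩
      · rw [map_mul] at h
        exact absurd h Bool.false_ne_true
      · obtain ⟨m, hm⟩ := hpow (of i)
        obtain ⟨n, hn⟩ := hpow v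
        exact ⟨m + n, by rw [map_mul, hm, hn, sPow_mul_sPow]⟩
  have h1 := hT e he fun i => cond (f i) t (t * t)
  rcases Bool.eq_false_or_eq_true (FreeSemigroup.lift f e.1) with h | h <;>
    rcases Bool.eq_false_or_eq_true (FreeSemigroup.lift f e.2) with h' | h'
  · exact absurd (h.trans h'.symm) hf
  · obtain ⟨n, hn⟩ := (key e.2).2 h'
    exact ⟨n, by rw [← hn, ← h1, (key e.1).1 h]⟩
  · obtain ⟨n, hn⟩ := (key e.1).2 h
    exact ⟨n, by rw [← hn, h1, (key e.2).1 h']⟩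
  · exact absurd (h.trans h'.symm) hf

theorem exists_sPow_eq_sPow_of_not_zmod {T : Type} [Semigroup T] {V : SemigroupVariety}
    (hT : MemVar T V) {p : ℕ} [NeZero p] (hV : ¬ MemVar (Multiplicative (ZMod p)) V) (t : T) :
    ∃ m n, sPow t m = sPow t n ∧ ¬ m ≡ n [MOD p] := by
  obtain ⟨e, he, f, hf⟩ := exists_failing_of_not_memVar hV
  have key : ∀ w : SgWord, ∃ n : ℕ,
      FreeSemigroup.lift (fun i => sPow t (Multiplicative.toAdd (f i) - 1).val) w = sPow t n ∧
      FreeSemigroup.lift f w = Multiplicative.ofAdd ((n : ZMod p) + 1) := by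
    intro w
    induction w using FreeSemigroup.recOnMul with
    | ih1 i => exact ⟨_, rfl, by simp⟩
    | ih2 i v hi hv =>
      obtain ⟨m, hm, hm'⟩ := hi
      obtain ⟨n, hn, hn'⟩ := hv
      refine ⟨m + n + 1, by rw [map_mul, hm, hn, sPow_mul_sPow], ?_⟩
      rw [map_mul, hm', hn', ← ofAdd_add]
      congr 1
      push_cast
      ring
  obtain ⟨m, hm, hm'⟩ := key e.1
  obtain ⟨n, hn, hn'⟩ := key e.2
  refine ⟨m, n, ?_, fun h => hf ?_⟩
  · rw [← hm, ← hn]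
    exact hT e he _
  · rw [hm', hn', (ZMod.natCast_eq_natCast_iff m n p).2 h]

theorem mul_self_of_sPow_eq {T : Type} [Semigroup T] {V : SemigroupVariety} (hT : MemVar T V)
    {t : T} {k : ℕ} (hk : sPow t (k + 1) = t)
    (hV : ∀ p : ℕ, p.Prime → p ∣ k + 1 → ¬ MemVar (Multiplicative (ZMod p)) V) : t * t = t := by
  have hper : Function.IsPeriodicPt (fun s => s * t) (k + 1) t := by
    rw [sPow_eq_iterate] at hk
    exact hk
  have hdvd := hper.minimalPeriod_dvd
  have hpos := hper.minimalPeriod_pos k.succ_pos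
  suffices h1 : Function.minimalPeriod (fun s => s * t) t = 1 from
    Function.minimalPeriod_eq_one_iff_isFixedPt (f := fun s => s * t) |>.1 h1
  by_contra h1
  obtain ⟨p, hp, hpd⟩ := Nat.exists_prime_and_dvd h1
  have : NeZero p := ⟨hp.ne_zero⟩
  obtain ⟨m, n, hmn, hne⟩ :=
    exists_sPow_eq_sPow_of_not_zmod hT (hV p hp (hpd.trans hdvd)) t
  rw [sPow_eq_iterate, sPow_eq_iterate, ← Function.iterate_mod_minimalPeriod_eq (n := m),
    ← Function.iterate_mod_minimalPeriod_eq (n := n),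
    Function.iterate_eq_iterate_iff_of_lt_minimalPeriod (Nat.mod_lt _ hpos)
      (Nat.mod_lt _ hpos)] at hmn
  exact hne (Nat.ModEq.of_dvd hpd hmn)

/-! ### A lattice condition singling out commutative varieties -/

/-- `V` lies properly below some element `W` all of whose nontrivial lower bounds are
above `V`. -/
def IsProperMonolith {L : Type*} [Lattice L] (V : L) : Prop :=
  ∃ W, (V ≤ W ∧ ¬ W ≤ V) ∧ ∀ U, U ≤ W → (∀ X, U ≤ X) ∨ V ≤ U

theorem le_all_of_lt_leftZero {V : SemigroupVariety}
    (hV : ∀ (T : Type) [Semigroup T], MemVar T V → ∀ a b : T, a * b = a)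
    (h : ¬ MemVar TwoLeftZero V) (W : SemigroupVariety) : V ≤ W :=
  le_all_of_subsingleton (fun T _ hT => ⟨fun a b => by
    have := mul_eq_right_of_not_leftZero hT h (fun a b => by rw [hV T hT, hV T hT])
      a b (hV T hT _ _)
    rw [← this, hV T hT]⟩) W

theorem le_all_of_lt_rightZero {V : SemigroupVariety}
    (hV : ∀ (T : Type) [Semigroup T], MemVar T V → ∀ a b : T, a * b = b)
    (h : ¬ MemVar TwoRightZero V) (W : SemigroupVariety) : V ≤ W :=
  le_all_of_subsingleton (fun T _ hT => ⟨fun a b => by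
    have := mul_eq_left_of_not_rightZero hT h (fun a b => hV T hT _ _)
      a b (hV T hT _ _)
    rw [← this, hV T hT]⟩) W

theorem le_of_mul_eq_left {V : SemigroupVariety}
    (hV : ∀ (T : Type) [Semigroup T], MemVar T V → ∀ a b : T, a * b = a) :
    V ≤ varGeneratedBy TwoLeftZero := by
  intro e he
  refine (V.mem_ids_iff e).2 fun T _ hT f => ?_
  have hhead : ∀ w : SgWord, FreeSemigroup.lift f w = f w.head := by
    intro w
    induction w using FreeSemigroup.recOnMul with
    | ih1 i => rfl
    | ih2 i v _ _ => rw [map_mul, hV T hT]; rfl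
  have hbool : ∀ (g : ℕ → TwoLeftZero) (w : SgWord), FreeSemigroup.lift g w = g w.head := by
    intro g w
    induction w using FreeSemigroup.recOnMul with
    | ih1 i => rfl
    | ih2 i v _ _ => rw [map_mul]; rfl
  have h1 := (hbool _ _).symm.trans ((he fun i => decide (i = e.1.head)).trans (hbool _ _))
  have h2 : e.2.head = e.1.head := by
    simpa using (show decide (e.1.head = e.1.head) = decide (e.2.head = e.1.head) from h1)
  rw [hhead, hhead, h2]

theorem le_of_mul_eq_right {V : SemigroupVariety}
    (hV : ∀ (T : Type) [Semigroup T], MemVar T V → ∀ a b : T, a * b = b) :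
    V ≤ varGeneratedBy TwoRightZero := by
  intro e he
  refine (V.mem_ids_iff e).2 fun T _ hT f => ?_
  have hlast : ∀ w : SgWord, ∃ i, FreeSemigroup.lift f w = f i ∧
      ∀ g : ℕ → TwoRightZero, FreeSemigroup.lift g w = g i := by
    intro w
    induction w using FreeSemigroup.recOnMul with
    | ih1 i => exact ⟨i, rfl, fun _ => rfl⟩
    | ih2 i v _ hv =>
      obtain ⟨j, hj, hj'⟩ := hv
      refine ⟨j, by rw [map_mul, hV T hT, hj], fun g => ?_⟩
      rw [map_mul, ← hj' g]
      rfl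
  obtain ⟨i, hi, hi'⟩ := hlast e.1
  obtain ⟨j, hj, hj'⟩ := hlast e.2
  have h1 := (hi' _).symm.trans ((he fun k => decide (k = i)).trans (hj' _))
  have h2 : j = i := by
    simpa using (show decide (i = i) = decide (j = i) from h1)
  rw [hi, hj, h2]

theorem IsProperMonolith.le_COMvar {V : SemigroupVariety} (h : IsProperMonolith V) :
    V ≤ COMvar := by
  obtain ⟨W, ⟨hVW, hWV⟩, hW⟩ := h
  have hgen : ∀ (S : Type) [Semigroup S] [Nontrivial S], MemVar S W → V ≤ varGeneratedBy S :=
    fun S _ _ hS => (hW _ (varGeneratedBy_le_iff.2 hS)).resolve_left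
      (not_varGeneratedBy_le_all S)
  by_cases hsl : MemVar TwoSemilattice W
  · exact (hgen _ hsl).trans (varGeneratedBy_le_COMvar Bool.and_comm)
  by_cases hzm : MemVar TwoNull W
  · exact (hgen _ hzm).trans (varGeneratedBy_le_COMvar fun _ _ => rfl)
  by_cases hab : ∃ p : ℕ, p.Prime ∧ MemVar (Multiplicative (ZMod p)) W
  · obtain ⟨p, hp, hpW⟩ := hab
    have : Fact p.Prime := ⟨hp⟩
    exact (hgen _ hpW).trans (varGeneratedBy_le_COMvar mul_comm)
  push Not at hab
  have hidem : ∀ (T : Type) [Semigroup T], MemVar T W → ∀ a : T, a * a = a := by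
    intro T _ hT a
    obtain ⟨n, hn⟩ := exists_sPow_eq_of_not_null hT hzm a
    exact mul_self_of_sPow_eq hT hn fun p hp _ => hab p hp
  have hrect : ∀ (T : Type) [Semigroup T], MemVar T W → ∀ a b : T, a * b * a = a :=
    fun T _ hT => rectangular_of_not_semilattice hT hsl (hidem T hT)
  have hsub : ∀ (T : Type) [Semigroup T], MemVar T V → MemVar T W :=
    fun T _ hT e he => hT e (hVW he)
  by_cases hrz : MemVar TwoRightZero W
  · by_cases hlz : MemVar TwoLeftZero W
    · rw [le_COMvar_iff]
      intro T _ hT a b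
      have h1 : ((wx * wy, wx) : SgEq) ∈ V.ids :=
        hgen _ hlz fun f => by simp only [map_mul]; rfl
      have h2 : ((wx * wy, wy) : SgEq) ∈ V.ids :=
        hgen _ hrz fun f => by simp only [map_mul]; rfl
      have h3 := hT _ h1 fun i => if i = 0 then a else b
      have h4 := hT _ h2 fun i => if i = 0 then b else a
      simp only [wx, wy, map_mul, FreeSemigroup.lift_of, if_true, one_ne_zero, if_false]
        at h3 h4
      rw [h3, h4]
    · have hWr : ∀ (T : Type) [Semigroup T], MemVar T W → ∀ a b : T, a * b = b :=
        fun T _ hT a b => mul_eq_right_of_not_leftZero hT hlz (hrect T hT) b a (hidem T hT b)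
      refine le_all_of_lt_rightZero (fun T _ hT => hWr T (hsub T hT)) (fun hV => hWV ?_) _
      exact (le_of_mul_eq_right hWr).trans (varGeneratedBy_le_iff.2 hV)
  · have hWl : ∀ (T : Type) [Semigroup T], MemVar T W → ∀ a b : T, a * b = a :=
      fun T _ hT a b => mul_eq_left_of_not_rightZero hT hrz (hrect T hT) a b (hidem T hT a)
    refine le_all_of_lt_leftZero (fun T _ hT => hWl T (hsub T hT)) (fun hV => hWV ?_) _
    exact (le_of_mul_eq_left hWl).trans (varGeneratedBy_le_iff.2 hV)

/-! ### Abelian groups of prime exponent -/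

theorem isProperMonolith_zmod (p : ℕ) [hp : Fact p.Prime] :
    IsProperMonolith (varGeneratedBy (Multiplicative (ZMod p))) := by
  have : NeZero p := ⟨hp.out.ne_zero⟩
  have hp1 := hp.out.one_lt
  have hcard : ∀ (n : ℕ) (a : Multiplicative (ZMod n)), a ^ n = 1 := fun n a => by
    rw [← toAdd_eq_zero]
    simp
  refine ⟨varGeneratedBy (Multiplicative (ZMod (p ^ 2))), ⟨?_, ?_⟩, fun U hU => ?_⟩
  · rw [varGeneratedBy_le_iff]
    intro e he f
    let φ : Multiplicative (ZMod (p ^ 2)) →* Multiplicative (ZMod p) :=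
      AddMonoidHom.toMultiplicative
        (ZMod.castHom (dvd_pow_self p two_ne_zero) (ZMod p)).toAddMonoidHom
    have hφ : Function.Surjective φ := ZMod.castHom_surjective (dvd_pow_self p two_ne_zero)
    choose g hg using fun i => hφ (f i)
    have key : ∀ w : SgWord, φ (FreeSemigroup.lift g w) = FreeSemigroup.lift f w := by
      intro w
      induction w using FreeSemigroup.recOnMul with
      | ih1 i => exact hg i
      | ih2 i v hi hv => rw [map_mul, map_mul, map_mul, hi, hv]
    rw [← key, ← key]
    exact congrArg φ (he g)
  · rw [varGeneratedBy_le_iff]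
    intro h
    have h1 : ((sPow wx p, wx) : SgEq) ∈ theoryOf (Multiplicative (ZMod p)) := fun f => by
      simp only [lift_sPow, sPow_eq_pow, pow_succ, hcard, one_mul]
    have h2 := h _ h1 fun _ => Multiplicative.ofAdd 1
    simp only [lift_sPow, sPow_eq_pow, wx, FreeSemigroup.lift_of, pow_succ, mul_eq_right,
      ← ofAdd_nsmul, ofAdd_eq_one, nsmul_eq_mul, mul_one] at h2
    rw [ZMod.natCast_eq_zero_iff] at h2
    exact absurd (Nat.le_of_dvd hp.out.pos h2) (by nlinarith)
  · rw [or_iff_not_imp_right, varGeneratedBy_le_iff]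
    intro hU' W
    refine le_all_of_subsingleton (fun T _ hT => ?_) W
    have hp2 : p ^ 2 - 1 + 1 = p ^ 2 := Nat.sub_add_cancel (Nat.one_le_pow _ _ hp.out.pos)
    have hcomm : ((wx * wy, wy * wx) : SgEq) ∈ U.ids := hU fun f => by
      simp only [map_mul, mul_comm]
    have hexp : ((sPow wx (p ^ 2 - 1) * wy, wy) : SgEq) ∈ U.ids := hU fun f => by
      simp only [map_mul, lift_sPow, sPow_eq_pow, hp2, hcard, one_mul]
    have hcomm' : ∀ a b : T, a * b = b * a := fun a b => by
      simpa [wx, wy] using hT _ hcomm fun i => if i = 0 then a else b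
    have hexp' : ∀ a b : T, sPow a (p ^ 2 - 1) * b = b := fun a b => by
      simpa [wx, wy, lift_sPow] using hT _ hexp fun i => if i = 0 then a else b
    have hidem : ∀ a : T, a * a = a := fun a => by
      refine mul_self_of_sPow_eq hT (hexp' a a) fun q hq hqd => ?_
      rw [hp2] at hqd
      rwa [(Nat.prime_dvd_prime_iff_eq hq hp.out).1 (hq.dvd_of_dvd_pow hqd)]
    have hpow : ∀ (a : T) (n : ℕ), sPow a n = a := fun a n => by
      induction n with
      | zero => rfl
      | succ n ih => rw [sPow, ih, hidem]
    refine ⟨fun a b => ?_⟩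
    have h1 := hexp' a b
    have h2 := hexp' b a
    rw [hpow] at h1 h2
    rw [← h2, hcomm', h1]

theorem COMvar_le_of_forall_zmod {V : SemigroupVariety}
    (h : ∀ p : ℕ, p.Prime → varGeneratedBy (Multiplicative (ZMod p)) ≤ V) : COMvar ≤ V := by
  intro e he S _ hS
  let c : SgWord →ₙ* Multiplicative (Multiset ℕ) :=
    FreeSemigroup.lift fun i => Multiplicative.ofAdd {i}
  have hcount : ∀ (p i : ℕ) (w : SgWord),
      FreeSemigroup.lift (fun j => Multiplicative.ofAdd (if j = i then (1 : ZMod p) else 0)) w =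
        Multiplicative.ofAdd ((Multiset.count i (Multiplicative.toAdd (c w)) : ℕ) : ZMod p) := by
    intro p i w
    induction w using FreeSemigroup.recOnMul with
    | ih1 j =>
      by_cases hj : j = i
      · simp [c, hj]
      · simp [c, hj, Ne.symm hj]
    | ih2 j v hj hv => rw [map_mul, hj, hv, map_mul, ← ofAdd_add]; simp
  have hc : c e.1 = c e.2 := by
    apply Multiplicative.toAdd.injective
    ext i
    obtain ⟨p, hpge, hp⟩ := Nat.exists_infinite_primes
      (Multiset.count i (Multiplicative.toAdd (c e.1)) +
        Multiset.count i (Multiplicative.toAdd (c e.2)) + 1)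
    have h1 := h p hp he fun j => Multiplicative.ofAdd (if j = i then (1 : ZMod p) else 0)
    rw [hcount, hcount] at h1
    exact Nat.ModEq.eq_of_lt_of_lt
      ((ZMod.natCast_eq_natCast_iff _ _ p).1 (Multiplicative.ofAdd.injective h1))
      (by omega) (by omega)
  have hcomm : ∀ a b : S, a * b = b * a := fun a b => by
    simpa [wx, wy] using hS _ rfl fun i => if i = 0 then a else b
  let _ : CommSemigroup S := { mul_comm := hcomm }
  intro f
  have key : ∀ w : SgWord, ((FreeSemigroup.lift f w : S) : WithOne S) =
      ((Multiplicative.toAdd (c w)).map fun i => (f i : WithOne S)).prod := by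
    intro w
    induction w using FreeSemigroup.recOnMul with
    | ih1 j => simp [c]
    | ih2 j v hj hv => rw [map_mul, WithOne.coe_mul, hj, hv, map_mul]; simp
  apply WithOne.coe_injective
  rw [key, key, hc]

theorem eq_COMvar_iff (V : SemigroupVariety) :
    V = COMvar ↔ ∀ W : SemigroupVariety, (∀ U, IsProperMonolith U → U ≤ W) ↔ V ≤ W := by
  have hCOM : ∀ W : SemigroupVariety, (∀ U, IsProperMonolith U → U ≤ W) ↔ COMvar ≤ W :=
    fun W => ⟨fun h => COMvar_le_of_forall_zmod fun p hp =>
      have : Fact p.Prime := ⟨hp⟩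
      h _ (isProperMonolith_zmod p), fun h _ hU => hU.le_COMvar.trans h⟩
  constructor
  · rintro rfl
    exact hCOM
  · intro h
    exact le_antisymm ((h _).1 ((hCOM _).2 le_rfl)) ((hCOM _).1 ((h _).2 le_rfl))

/-! ### The defining formula -/

/-- The atomic formula expressing `s ≤ t` as `s ⊔ t = t`. -/
def leFormula {n : ℕ} (s t : latticeLang.Term (Fin 1 ⊕ Fin n)) :
    latticeLang.BoundedFormula (Fin 1) n :=
  (Language.Term.func (l := 2) (show latticeLang.Functions 2 from (0 : Fin 2)) ![s, t]).bdEqual t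

theorem realize_leFormula {L : Type*} [Lattice L] {n : ℕ}
    (s t : latticeLang.Term (Fin 1 ⊕ Fin n)) (v : Fin 1 → L) (xs : Fin n → L) :
    (leFormula s t).Realize v xs ↔
      s.realize (Sum.elim v xs) ≤ t.realize (Sum.elim v xs) := by
  rw [leFormula, Language.BoundedFormula.realize_bdEqual, ← sup_eq_right]
  rfl

/-- The formula expressing that the bound variable `1` is a proper monolith. -/
def properMonolithFormula : latticeLang.BoundedFormula (Fin 1) 2 :=
  ((leFormula (.var (.inr 1)) (.var (.inr 2)) ⊓ (leFormula (.var (.inr 2)) (.var (.inr 1))).not) ⊓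
    ((leFormula (.var (.inr 3)) (.var (.inr 2))).imp
      ((leFormula (.var (.inr 3)) (.var (.inr 4))).all ⊔
        leFormula (.var (.inr 1)) (.var (.inr 3)))).all).ex

theorem realize_properMonolithFormula {L : Type*} [Lattice L] (v : Fin 1 → L) (xs : Fin 2 → L) :
    properMonolithFormula.Realize v xs ↔ IsProperMonolith (xs 1) := by
  simp only [properMonolithFormula, IsProperMonolith, Language.BoundedFormula.realize_ex,
    Language.BoundedFormula.realize_inf, Language.BoundedFormula.realize_not,
    Language.BoundedFormula.realize_all, Language.BoundedFormula.realize_imp,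
    Language.BoundedFormula.realize_sup, realize_leFormula]
  rfl

/-- The formula expressing that the free variable is the least upper bound of the proper
monoliths. -/
def supProperMonolithFormula : latticeLang.Formula (Fin 1) :=
  Language.BoundedFormula.all (((properMonolithFormula.imp
    (leFormula (.var (.inr 1)) (.var (.inr 0)))).all).iff
      (leFormula (n := 1) (.var (.inl 0)) (.var (.inr 0))))

theorem realize_supProperMonolithFormula {L : Type*} [Lattice L] (a : L) :
    supProperMonolithFormula.Realize (fun _ => a) ↔
      ∀ y : L, (∀ x, IsProperMonolith x → x ≤ y) ↔ a ≤ y := by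
  simp only [supProperMonolithFormula, Language.Formula.Realize,
    Language.BoundedFormula.realize_all, Language.BoundedFormula.realize_iff,
    Language.BoundedFormula.realize_imp, realize_leFormula, realize_properMonolithFormula]
  rfl

/-- The variety `COM = var{xy = yx}` of all commutative
semigroups is definable. -/
theorem COM_definable : IsDefinableVar {COMvar} := by
  exact ⟨supProperMonolithFormula, fun V =>
    (realize_supProperMonolithFormula V).trans (eq_COMvar_iff V).symm⟩
end
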